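/- If u : ℍ → ℝ is a smooth solution of y²·((∂u/∂x)² + (∂u/∂y)²) − 2y·(∂u/∂x) = 0 on the upper half plane, then u is either constant or there exist a ∈ ℝ and c ∈ ℝ such that u(x,y) = 2·arctan((x−a)/y) + c for all (x,y) with y > 0. -/

import Mathlib

/-- The open upper half plane. -/
def UHP : Set (ℝ × ℝ) := {p : ℝ × ℝ | 0 < p.2}

lemma UHP_open : IsOpen UHP := isOpen_lt continuous_const continuous_snd

lemma UHP_preconn : IsPreconnected UHP :=
  (convex_halfSpace_gt (f := fun p : ℝ × ℝ => p.2) (by constructor <;> simp) 0).isPreconnected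

lemma lin_forward {w1 w2 A B C D : ℝ → ℝ} (hA : Continuous A) (hB : Continuous B)
    (hC : Continuous C) (hD : Continuous D)
    (h1 : ∀ t, HasDerivAt w1 (A t * w1 t + B t * w2 t) t)
    (h2 : ∀ t, HasDerivAt w2 (C t * w1 t + D t * w2 t) t) {t0 : ℝ}
    (z1 : w1 t0 = 0) (z2 : w2 t0 = 0) {t : ℝ} (ht : t0 ≤ t) : w1 t = 0 ∧ w2 t = 0 := by
  have hcont : Continuous (fun t => |A t| + |B t| + |C t| + |D t|) := by fun_prop
  obtain ⟨K, hK⟩ := (isCompact_Icc (a := t0) (b := t)).exists_bound_of_continuousOn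
    hcont.continuousOn
  have hd : ∀ t, HasDerivAt (fun t => (w1 t, w2 t))
      (A t * w1 t + B t * w2 t, C t * w1 t + D t * w2 t) t := fun t => (h1 t).prodMk (h2 t)
  have key := eq_zero_of_abs_deriv_le_mul_abs_self_of_eq_zero_right
    (f := fun t => (w1 t, w2 t))
    (f' := fun t => (A t * w1 t + B t * w2 t, C t * w1 t + D t * w2 t))
    (K := K) (a := t0) (b := t)
    (fun s _ => (hd s).continuousAt.continuousWithinAt)
    (fun s _ => (hd s).hasDerivWithinAt) (by simp [z1, z2]) (by
      intro s hs
      have hk := hK s ⟨hs.1, hs.2.le⟩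
      rw [Real.norm_eq_abs, abs_of_nonneg (by positivity)] at hk
      set n := ‖(w1 s, w2 s)‖ with hn
      have n1 : |w1 s| ≤ n := norm_fst_le (w1 s, w2 s)
      have n2 : |w2 s| ≤ n := norm_snd_le (w1 s, w2 s)
      have n0 : 0 ≤ n := norm_nonneg _
      have hgen : ∀ a b : ℝ, |a| + |b| ≤ K → |a * w1 s + b * w2 s| ≤ K * n := by
        intro a b hab
        calc |a * w1 s + b * w2 s| ≤ |a * w1 s| + |b * w2 s| := abs_add_le _ _
          _ = |a| * |w1 s| + |b| * |w2 s| := by rw [abs_mul, abs_mul]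
          _ ≤ |a| * n + |b| * n := by gcongr
          _ = (|a| + |b|) * n := by ring
          _ ≤ K * n := by gcongr
      have p1 := abs_nonneg (A s)
      have p2 := abs_nonneg (B s)
      have p3 := abs_nonneg (C s)
      have p4 := abs_nonneg (D s)
      exact norm_prod_le_iff.2 ⟨hgen _ _ (by linarith), hgen _ _ (by linarith)⟩)
    t ⟨ht, le_rfl⟩
  simpa using key

lemma lin_unique {w1 w2 A B C D : ℝ → ℝ} (hA : Continuous A) (hB : Continuous B)
    (hC : Continuous C) (hD : Continuous D)
    (h1 : ∀ t, HasDerivAt w1 (A t * w1 t + B t * w2 t) t)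
    (h2 : ∀ t, HasDerivAt w2 (C t * w1 t + D t * w2 t) t) {t0 : ℝ}
    (z1 : w1 t0 = 0) (z2 : w2 t0 = 0) (t : ℝ) : w1 t = 0 ∧ w2 t = 0 := by
  rcases le_total t0 t with h | h
  · exact lin_forward hA hB hC hD h1 h2 z1 z2 h
  · have := lin_forward (w1 := fun s => w1 (-s)) (w2 := fun s => w2 (-s))
      (A := fun s => -A (-s)) (B := fun s => -B (-s)) (C := fun s => -C (-s))
      (D := fun s => -D (-s)) (by fun_prop) (by fun_prop) (by fun_prop) (by fun_prop)
      (fun s => by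
        have := (h1 (-s)).scomp s (hasDerivAt_neg s)
        refine this.congr_deriv ?_
        simp; ring)
      (fun s => by
        have := (h2 (-s)).scomp s (hasDerivAt_neg s)
        refine this.congr_deriv ?_
        simp; ring)
      (t0 := -t0) (by simpa using z1) (by simpa using z2) (t := -t) (by linarith)
    simpa using this

/-- A curl-free `C¹` field `(p,q)` on the half plane solving the equation. -/
structure HJSol (p q : ℝ × ℝ → ℝ) : Prop where
  cp : ContDiffOn ℝ 1 p UHP
  cq : ContDiffOn ℝ 1 q UHP
  symm : ∀ z ∈ UHP, fderiv ℝ p z (0, 1) = fderiv ℝ q z (1, 0)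
  eq : ∀ x y : ℝ, 0 < y → y ^ 2 * (p (x, y) ^ 2 + q (x, y) ^ 2) - 2 * y * p (x, y) = 0

lemma curve_deriv {p : ℝ × ℝ → ℝ} (cp : ContDiffOn ℝ 1 p UHP) {X Y : ℝ → ℝ} {X' Y' t : ℝ}
    (hX : HasDerivAt X X' t) (hY : HasDerivAt Y Y' t) (h : 0 < Y t) :
    HasDerivAt (fun s => p (X s, Y s))
      (fderiv ℝ p (X t, Y t) (1, 0) * X' + fderiv ℝ p (X t, Y t) (0, 1) * Y') t := by
  have hd : DifferentiableAt ℝ p (X t, Y t) :=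
    (cp.contDiffAt (UHP_open.mem_nhds h)).differentiableAt (by simp)
  have := hd.hasFDerivAt.comp_hasDerivAt t (hX.prodMk hY)
  refine this.congr_deriv ?_
  have e : ((X', Y') : ℝ × ℝ) = X' • (1, 0) + Y' • (0, 1) := by simp
  rw [e, map_add, map_smul, map_smul]
  simp; ring

lemma curve_cont {p : ℝ × ℝ → ℝ} (cp : ContDiffOn ℝ 1 p UHP) {X Y : ℝ → ℝ}
    (hX : Continuous X) (hY : Continuous Y) (h : ∀ t, 0 < Y t) (v : ℝ × ℝ) :
    Continuous (fun s => fderiv ℝ p (X s, Y s) v) := by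
  have h1 := cp.continuousOn_fderiv_of_isOpen UHP_open le_rfl
  have h2 : Continuous (fun s => fderiv ℝ p (X s, Y s)) :=
    h1.comp_continuous (hX.prodMk hY) h
  exact h2.clm_apply continuous_const

namespace HJSol
variable {p q : ℝ × ℝ → ℝ}

lemma dx (S : HJSol p q) {x y : ℝ} (hy : 0 < y) :
    (y ^ 2 * p (x, y) - y) * fderiv ℝ p (x, y) (1, 0) +
      y ^ 2 * q (x, y) * fderiv ℝ q (x, y) (1, 0) = 0 := by
  have h1 := curve_deriv S.cp (hasDerivAt_id x) (hasDerivAt_const x y) hy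
  have h2 := curve_deriv S.cq (hasDerivAt_id x) (hasDerivAt_const x y) hy
  have h3 := (((h1.pow 2).add (h2.pow 2)).const_mul (y ^ 2)).sub (h1.const_mul (2 * y))
  have h4 : HasDerivAt (fun _ : ℝ => (0 : ℝ)) 0 x := hasDerivAt_const _ _
  have h5 := h3.congr_of_eventuallyEq (f₁ := fun _ : ℝ => (0 : ℝ))
    (Filter.Eventually.of_forall fun s => by
      have := S.eq s y hy
      simp only [Pi.sub_apply, Pi.add_apply, Pi.pow_apply, id]
      linarith)
  have := h5.unique h4
  simp only [id, Nat.cast_ofNat] at this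
  linear_combination this / 2

lemma dy (S : HJSol p q) {x y : ℝ} (hy : 0 < y) :
    (y ^ 2 * p (x, y) - y) * fderiv ℝ q (x, y) (1, 0) +
      y ^ 2 * q (x, y) * fderiv ℝ q (x, y) (0, 1) +
      y * (p (x, y) ^ 2 + q (x, y) ^ 2) - p (x, y) = 0 := by
  have h1 := curve_deriv S.cp (hasDerivAt_const y x) (hasDerivAt_id y) hy
  have h2 := curve_deriv S.cq (hasDerivAt_const y x) (hasDerivAt_id y) hy
  have h3 := (((hasDerivAt_id y).pow 2).mul ((h1.pow 2).add (h2.pow 2))).sub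
    (((hasDerivAt_id y).const_mul 2).mul h1)
  have h4 : HasDerivAt (fun _ : ℝ => (0 : ℝ)) 0 y := hasDerivAt_const _ _
  have h5 := h3.congr_of_eventuallyEq (f₁ := fun _ : ℝ => (0 : ℝ))
    (by
      filter_upwards [lt_mem_nhds hy] with s hs
      have := S.eq x s hs
      simp only [Pi.sub_apply, Pi.add_apply, Pi.pow_apply, Pi.mul_apply, id]
      linarith)
  have := h5.unique h4
  simp only [id, Nat.cast_ofNat, Pi.add_apply, Pi.pow_apply] at this
  rw [S.symm (x, y) hy] at this
  linear_combination this / 2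

/-- Propagation along characteristics. -/
lemma propagate (S : HJSol p q) {X Y P Q : ℝ → ℝ} (hYpos : ∀ t, 0 < Y t)
    (hX : ∀ t, HasDerivAt X (Y t ^ 2 * P t - Y t) t)
    (hY : ∀ t, HasDerivAt Y (Y t ^ 2 * Q t) t)
    (hP : ∀ t, HasDerivAt P 0 t)
    (hQ : ∀ t, HasDerivAt Q (-(Y t * (P t ^ 2 + Q t ^ 2) - P t)) t) {t0 : ℝ}
    (i1 : p (X t0, Y t0) = P t0) (i2 : q (X t0, Y t0) = Q t0) (t : ℝ) :
    p (X t, Y t) = P t ∧ q (X t, Y t) = Q t := by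
  have cX : Continuous X := continuous_iff_continuousAt.2 fun t => (hX t).continuousAt
  have cY : Continuous Y := continuous_iff_continuousAt.2 fun t => (hY t).continuousAt
  have cP : Continuous P := continuous_iff_continuousAt.2 fun t => (hP t).continuousAt
  have cQ : Continuous Q := continuous_iff_continuousAt.2 fun t => (hQ t).continuousAt
  have dp := fun t => curve_deriv S.cp (hX t) (hY t) (hYpos t)
  have dq := fun t => curve_deriv S.cq (hX t) (hY t) (hYpos t)
  have cp : Continuous (fun t => p (X t, Y t)) :=
    continuous_iff_continuousAt.2 fun t => (dp t).continuousAt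
  have cq : Continuous (fun t => q (X t, Y t)) :=
    continuous_iff_continuousAt.2 fun t => (dq t).continuousAt
  have c1 := curve_cont S.cp cX cY hYpos (1, 0)
  have c2 := curve_cont S.cq cX cY hYpos (1, 0)
  have c3 := curve_cont S.cq cX cY hYpos (0, 1)
  have := lin_unique (w1 := fun t => p (X t, Y t) - P t) (w2 := fun t => q (X t, Y t) - Q t)
    (A := fun t => -(Y t) ^ 2 * fderiv ℝ p (X t, Y t) (1, 0))
    (B := fun t => -(Y t) ^ 2 * fderiv ℝ q (X t, Y t) (1, 0))
    (C := fun t => -(Y t) ^ 2 * fderiv ℝ q (X t, Y t) (1, 0) - Y t * (p (X t, Y t) + P t) + 1)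
    (D := fun t => -(Y t) ^ 2 * fderiv ℝ q (X t, Y t) (0, 1) - Y t * (q (X t, Y t) + Q t))
    ((cY.pow 2).neg.mul c1) ((cY.pow 2).neg.mul c2)
    ((((cY.pow 2).neg.mul c2).sub (cY.mul (cp.add cP))).add continuous_const)
    (((cY.pow 2).neg.mul c3).sub (cY.mul (cq.add cQ)))
    (fun t => by
      refine HasDerivAt.congr_deriv ((dp t).sub (hP t)) ?_
      rw [S.symm _ (hYpos t)]
      linear_combination S.dx (x := X t) (hYpos t))
    (fun t => by
      refine HasDerivAt.congr_deriv ((dq t).sub (hQ t)) ?_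
      linear_combination S.dy (x := X t) (hYpos t))
    (t0 := t0) (by simp [i1]) (by simp [i2]) t
  exact ⟨by linarith [this.1], by linarith [this.2]⟩

lemma p_nonneg (S : HJSol p q) {x y : ℝ} (hy : 0 < y) : 0 ≤ p (x, y) := by
  have := S.eq x y hy
  have h : 2 * y * p (x, y) = y ^ 2 * (p (x, y) ^ 2 + q (x, y) ^ 2) := by linarith
  have h2 : 0 ≤ (2 * y) * p (x, y) := by rw [h]; positivity
  exact nonneg_of_mul_nonneg_right h2 (by linarith)

lemma q_zero (S : HJSol p q) {x y : ℝ} (hy : 0 < y) (h : p (x, y) = 0) : q (x, y) = 0 := by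
  have := S.eq x y hy
  rw [h] at this
  have h2 : y ^ 2 * q (x, y) ^ 2 = 0 := by linarith
  simpa [hy.ne'] using h2

lemma line (S : HJSol p q) {x y : ℝ} (hy : 0 < y) (h : p (x, y) = 0) (x' : ℝ) :
    p (x', y) = 0 := by
  have := S.propagate (X := fun t => x - y * t) (Y := fun _ => y) (P := fun _ => 0)
    (Q := fun _ => 0) (fun _ => hy)
    (fun t => by
      refine HasDerivAt.congr_deriv (((hasDerivAt_id t).const_mul y).const_sub x) ?_
      simp)
    (fun t => by simpa using hasDerivAt_const t y)
    (fun t => hasDerivAt_const t 0)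
    (fun t => by simpa using hasDerivAt_const t (0 : ℝ)) (t0 := 0)
    (by simpa using h) (by simpa using S.q_zero hy h) ((x - x') / y)
  have h1 := this.1
  have e : x - y * ((x - x') / y) = x' := by field_simp; ring
  simpa only [e] using h1

/-- Propagation along a horocycle based at `a` of Euclidean diameter `h`. -/
lemma circle (S : HJSol p q) {a h s0 : ℝ} (hh : 0 < h)
    (i1 : p (a + h * s0 / (1 + s0 ^ 2), h / (1 + s0 ^ 2)) = 2 / h)
    (i2 : q (a + h * s0 / (1 + s0 ^ 2), h / (1 + s0 ^ 2)) = -2 * s0 / h) (s : ℝ) :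
    p (a + h * s / (1 + s ^ 2), h / (1 + s ^ 2)) = 2 / h ∧
    q (a + h * s / (1 + s ^ 2), h / (1 + s ^ 2)) = -2 * s / h := by
  have hd : ∀ t : ℝ, HasDerivAt (fun t : ℝ => 1 + t ^ 2) (2 * t) t := fun t => by
    simpa using (hasDerivAt_pow 2 t).const_add 1
  have hne : ∀ t : ℝ, 1 + t ^ 2 ≠ 0 := fun t => by positivity
  refine S.propagate (X := fun s => a + h * s / (1 + s ^ 2)) (Y := fun s => h / (1 + s ^ 2))
    (P := fun _ => 2 / h) (Q := fun s => -2 * s / h) (fun t => by positivity)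
    (fun t => ?_) (fun t => ?_) (fun t => hasDerivAt_const _ _) (fun t => ?_) i1 i2 s
  · refine HasDerivAt.congr_deriv ((((hasDerivAt_id t).const_mul h).div (hd t) (hne t)).const_add a) ?_
    have := hne t
    simp only [id]
    field_simp
    ring
  · refine HasDerivAt.congr_deriv ((hasDerivAt_const t h).div (hd t) (hne t)) ?_
    have := hne t
    field_simp
    ring
  · refine HasDerivAt.congr_deriv (((hasDerivAt_id t).const_mul (-2)).div_const h) ?_
    have := hne t
    field_simp
    ring

lemma circle' (S : HJSol p q) {x y : ℝ} (hy : 0 < y) (hp : 0 < p (x, y)) (s : ℝ) {X Y : ℝ}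
    (hY : Y = 2 / p (x, y) / (1 + s ^ 2))
    (hX : X = x + y * q (x, y) / p (x, y) + Y * s) :
    p (X, Y) = p (x, y) ∧ q (X, Y) = - p (x, y) * s := by
  have he := S.eq x y hy
  set P := p (x, y) with hP
  set Q := q (x, y) with hQ
  have he' : y * (P ^ 2 + Q ^ 2) = 2 * P := by
    have : y * (y * (P ^ 2 + Q ^ 2) - 2 * P) = 0 := by linarith
    rcases mul_eq_zero.1 this with h | h <;> linarith
  have e1 : 2 / P / (1 + (-Q / P) ^ 2) = y := by
    field_simp
    linarith
  have e2 : x + y * Q / P + 2 / P * (-Q / P) / (1 + (-Q / P) ^ 2) = x := by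
    rw [mul_div_right_comm (2 / P), e1]; ring
  have := S.circle (a := x + y * Q / P) (h := 2 / P) (s0 := -Q / P) (by positivity)
    (by rw [e1, e2, ← hP]; field_simp) (by rw [e1, e2, ← hQ]; field_simp) s
  have hX' : X = x + y * Q / P + 2 / P * s / (1 + s ^ 2) := by
    rw [hX, hY]; ring
  rw [← hY, ← hX'] at this
  refine ⟨by rw [this.1]; field_simp, by rw [this.2]; field_simp⟩

lemma gap_zero (S : HJSol p q) {x0 y0 x y : ℝ} (hy0 : 0 < y0) (h0 : p (x0, y0) = 0)
    (hy : 0 < y) (hp : 0 < p (x, y)) : 2 / y0 < p (x, y) := by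
  by_contra! hle
  have hs : 0 ≤ 2 / p (x, y) / y0 - 1 := by
    rw [le_div_iff₀ hy0] at hle
    rw [sub_nonneg, div_div, le_div_iff₀ (by positivity)]
    linarith
  have := (S.circle' hy hp (√(2 / p (x, y) / y0 - 1)) (Y := y0)
    (by rw [Real.sq_sqrt hs]; field_simp; ring) rfl).1
  rw [S.line hy0 h0] at this
  linarith

lemma gap_base (S : HJSol p q) {x y x' y' : ℝ} (hy : 0 < y) (hp : 0 < p (x, y))
    (hy' : 0 < y') (hp' : 0 < p (x', y'))
    (hle : ((x + y * q (x, y) / p (x, y)) - (x' + y' * q (x', y') / p (x', y'))) ^ 2 ≤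
      (2 / p (x, y)) * (2 / p (x', y'))) :
    x + y * q (x, y) / p (x, y) = x' + y' * q (x', y') / p (x', y') := by
  by_contra hne
  have c1 := @circle' p q S x y hy hp
  have c2 := @circle' p q S x' y' hy' hp'
  set a := x + y * q (x, y) / p (x, y)
  set a' := x' + y' * q (x', y') / p (x', y')
  set P := p (x, y)
  set P' := p (x', y')
  obtain ⟨d, hd⟩ : ∃ d, d = a - a' := ⟨_, rfl⟩
  have hd0 : d ≠ 0 := by rw [hd]; exact sub_ne_zero.2 hne
  rw [← hd] at hle
  obtain ⟨h, hh⟩ : ∃ h, h = 2 / P := ⟨_, rfl⟩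
  obtain ⟨h', hh'⟩ : ∃ h', h' = 2 / P' := ⟨_, rfl⟩
  rw [← hh, ← hh'] at hle
  have hpos : 0 < h := by rw [hh]; positivity
  have hpos' : 0 < h' := by rw [hh']; positivity
  obtain ⟨R, hR⟩ : ∃ R, R = √(h * h' - d ^ 2) := ⟨_, rfl⟩
  have hR2 : R ^ 2 = h * h' - d ^ 2 := by rw [hR]; exact Real.sq_sqrt (by linarith)
  obtain ⟨s, hs⟩ : ∃ s, s = (-h + R) / d := ⟨_, rfl⟩
  have hs' : d * s + h = R := by rw [hs]; field_simp; ring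
  have key : h ^ 2 + 2 * h * s * d + d ^ 2 * (1 + s ^ 2) = h * h' := by
    rw [← hs'] at hR2; linarith
  have hns : 1 + s ^ 2 ≠ 0 := by positivity
  obtain ⟨Y, hY⟩ : ∃ Y, Y = h / (1 + s ^ 2) := ⟨_, rfl⟩
  have hYpos : 0 < Y := by rw [hY]; positivity
  obtain ⟨s', hs2⟩ : ∃ s', s' = s + d / Y := ⟨_, rfl⟩
  have hns' : 1 + s' ^ 2 ≠ 0 := by positivity
  have hY' : Y = h' / (1 + s' ^ 2) := by
    rw [eq_div_iff hns']
    have e : Y * (1 + s ^ 2) = h := by rw [hY]; field_simp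
    have e2 : Y * s' = Y * s + d := by rw [hs2]; field_simp
    have : h * (Y * (1 + s' ^ 2)) = h * h' := by
      rw [← key]
      have : Y * (Y * (1 + s' ^ 2)) = Y ^ 2 * (1 + s ^ 2) + 2 * Y * s * d + d ^ 2 := by
        linear_combination (Y * s' + Y * s + d) * e2
      rw [← e]
      linear_combination (1 + s ^ 2) * this
    exact mul_left_cancel₀ hpos.ne' this
  have r1 := c1 s (X := a + Y * s) (Y := Y) (by rw [hY, hh]) rfl
  have r2 := c2 s' (X := a + Y * s) (Y := Y) (by rw [hY', hh']) (by
    rw [hs2, mul_add, mul_div_cancel₀ _ hYpos.ne', hd]; ring)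
  have hPP : P = P' := by rw [← r1.1, r2.1]
  have hqq : P * s = P * s' := by
    have := r1.2.symm.trans r2.2
    rw [← hPP] at this; linarith
  have : s = s' := mul_left_cancel₀ hp.ne' hqq
  rw [hs2] at this
  have : d / Y = 0 := by linarith
  rcases div_eq_zero_iff.1 this with h | h
  · exact hd0 h
  · exact hYpos.ne' h

end HJSol

lemma const_of_locally {f : ℝ × ℝ → ℝ} (hf : ∀ z ∈ UHP, ∀ᶠ w in nhds z, f w = f z)
    {z w : ℝ × ℝ} (hz : z ∈ UHP) (hw : w ∈ UHP) : f z = f w := by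
  have h : ∀ z ∈ UHP, HasFDerivAt f (0 : ℝ × ℝ →L[ℝ] ℝ) z := fun z hz =>
    (hasFDerivAt_const (f z) z).congr_of_eventuallyEq (hf z hz)
  exact UHP_open.is_const_of_fderiv_eq_zero UHP_preconn
    (fun z hz => (h z hz).differentiableAt.differentiableWithinAt)
    (fun z hz => (h z hz).fderiv) hz hw

namespace HJSol
variable {p q : ℝ × ℝ → ℝ}

lemma all_zero (S : HJSol p q) {z0 : ℝ × ℝ} (hz0 : z0 ∈ UHP) (h0 : p z0 = 0) {z : ℝ × ℝ}
    (hz : z ∈ UHP) : p z = 0 := by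
  classical
  have hy0 : 0 < z0.2 := hz0
  have := const_of_locally (f := fun z => if p z = 0 then 0 else 1) (fun z hz => by
    have hc : ContinuousAt p z := (S.cp.contDiffAt (UHP_open.mem_nhds hz)).continuousAt
    by_cases h : p z = 0
    · have h2 : p z < 2 / z0.2 := by rw [h]; positivity
      filter_upwards [hc.eventually (gt_mem_nhds h2), UHP_open.mem_nhds hz] with w hw hwU
      have : p w = 0 := by
        by_contra hne
        have hpos : 0 < p w := lt_of_le_of_ne (S.p_nonneg (x := w.1) (y := w.2) hwU) (Ne.symm hne)
        have := S.gap_zero (x0 := z0.1) (y0 := z0.2) (x := w.1) (y := w.2) hy0 h0 hwU hpos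
        exact absurd this (not_lt.2 hw.le)
      simp [this, h]
    · filter_upwards [hc.eventually_ne h] with w hw
      simp [hw, h]) hz0 hz
  by_contra hne
  simp [h0, hne] at this

lemma base_const (S : HJSol p q) (hp : ∀ z ∈ UHP, 0 < p z) {z w : ℝ × ℝ}
    (hz : z ∈ UHP) (hw : w ∈ UHP) :
    z.1 + z.2 * q z / p z = w.1 + w.2 * q w / p w := by
  refine const_of_locally (f := fun z => z.1 + z.2 * q z / p z) (fun z hz => ?_) hz hw
  have hc : ContinuousAt p z := (S.cp.contDiffAt (UHP_open.mem_nhds hz)).continuousAt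
  have hc' : ContinuousAt q z := (S.cq.contDiffAt (UHP_open.mem_nhds hz)).continuousAt
  have hpz := hp z hz
  have hne : p z ≠ 0 := hpz.ne'
  have hL : ContinuousAt (fun w : ℝ × ℝ =>
      ((w.1 + w.2 * q w / p w) - (z.1 + z.2 * q z / p z)) ^ 2 - (2 / p w) * (2 / p z)) z := by
    fun_prop (disch := assumption)
  have hneg : ((z.1 + z.2 * q z / p z) - (z.1 + z.2 * q z / p z)) ^ 2
      - (2 / p z) * (2 / p z) < 0 := by
    have : 0 < (2 / p z) * (2 / p z) := by positivity
    rw [sub_self]; linarith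
  filter_upwards [hL.eventually (gt_mem_nhds hneg), UHP_open.mem_nhds hz] with w hw hwU
  exact S.gap_base (x := w.1) (y := w.2) (x' := z.1) (y' := z.2) hwU (hp w hwU) hz hpz
    (by linarith [hw])

end HJSol

lemma part_x {F : ℝ × ℝ → ℝ} {z : ℝ × ℝ} (hF : DifferentiableAt ℝ F z) :
    HasDerivAt (fun t => F (t, z.2)) (fderiv ℝ F z (1, 0)) z.1 :=
  HasFDerivAt.comp_hasDerivAt z.1 (l := F) (f := fun t => (t, z.2)) hF.hasFDerivAt
    ((hasDerivAt_id z.1).prodMk (hasDerivAt_const z.1 z.2))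

lemma part_y {F : ℝ × ℝ → ℝ} {z : ℝ × ℝ} (hF : DifferentiableAt ℝ F z) :
    HasDerivAt (fun t => F (z.1, t)) (fderiv ℝ F z (0, 1)) z.2 :=
  HasFDerivAt.comp_hasDerivAt z.2 (l := F) (f := fun t => (z.1, t)) hF.hasFDerivAt
    ((hasDerivAt_const z.2 z.1).prodMk (hasDerivAt_id z.2))

/-- Every smooth solution of the Hamilton-Jacobi equation of the horocycle flow
on the upper half plane is either constant or equals
`(x,y) ↦ 2·arctan((x−a)/y) + c` for some `a, c ∈ ℝ`. -/
theorem horocycle_HJ_classification (u : ℝ × ℝ → ℝ)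
    (hsmooth : ContDiffOn ℝ (⊤ : ℕ∞) u {p : ℝ × ℝ | 0 < p.2})
    (hHJ : ∀ x y : ℝ, 0 < y →
      y ^ 2 * ((fderiv ℝ u (x, y) (1, 0)) ^ 2 + (fderiv ℝ u (x, y) (0, 1)) ^ 2) -
        2 * y * (fderiv ℝ u (x, y) (1, 0)) = 0) :
    (∃ c : ℝ, ∀ x y : ℝ, 0 < y → u (x, y) = c) ∨
    (∃ a c : ℝ, ∀ x y : ℝ, 0 < y →
      u (x, y) = 2 * Real.arctan ((x - a) / y) + c) := by

  have hs : ContDiffOn ℝ (⊤ : ℕ∞) u UHP := hsmooth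
  have hfd : ContDiffOn ℝ 1 (fderiv ℝ u) UHP := hs.fderiv_of_isOpen UHP_open (by
    exact WithTop.coe_le_coe.2 (le_top : (1 + 1 : ℕ∞) ≤ ⊤))
  have hdd : ∀ z ∈ UHP, DifferentiableAt ℝ (fderiv ℝ u) z := fun z hz =>
    (hfd.contDiffAt (UHP_open.mem_nhds hz)).differentiableAt (by simp)
  have hud : ∀ z ∈ UHP, DifferentiableAt ℝ u z := fun z hz =>
    (hs.contDiffAt (UHP_open.mem_nhds hz)).differentiableAt (by simp)
  have hap : ∀ v w, ∀ z ∈ UHP, fderiv ℝ (fun z => fderiv ℝ u z v) z w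
      = fderiv ℝ (fderiv ℝ u) z w v := by
    intro v w z hz
    have := ((hdd z hz).hasFDerivAt.clm_apply (hasFDerivAt_const v z)).fderiv
    rw [this]; simp
  have S : HJSol (fun z => fderiv ℝ u z (1, 0)) (fun z => fderiv ℝ u z (0, 1)) :=
    { cp := hfd.clm_apply contDiffOn_const
      cq := hfd.clm_apply contDiffOn_const
      symm := fun z hz => by
        rw [hap _ _ z hz, hap _ _ z hz]
        exact (hs.contDiffAt (UHP_open.mem_nhds hz)).isSymmSndFDerivAt (by
          simp only [minSmoothness_of_isRCLikeNormedField]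
          exact WithTop.coe_le_coe.2 (le_top : (2 : ℕ∞) ≤ ⊤)) _ _
      eq := hHJ }
  by_cases hex : ∃ z0 ∈ UHP, fderiv ℝ u z0 (1, 0) = 0
  · left
    obtain ⟨z0, hz0, h0⟩ := hex
    obtain ⟨c, hc⟩ := UHP_open.exists_is_const_of_fderiv_eq_zero UHP_preconn
      (fun z hz => (hud z hz).differentiableWithinAt) (fun z hz => by
        have e1 : fderiv ℝ u z (1, 0) = 0 := S.all_zero hz0 h0 hz
        have e2 : fderiv ℝ u z (0, 1) = 0 := S.q_zero (x := z.1) (y := z.2) hz e1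
        ext <;> simp [e1, e2])
    exact ⟨c, fun x y hy => hc (x, y) hy⟩
  · right
    push Not at hex
    have hpos : ∀ z ∈ UHP, 0 < fderiv ℝ u z (1, 0) := fun z hz =>
      lt_of_le_of_ne (S.p_nonneg (x := z.1) (y := z.2) hz) (Ne.symm (hex z hz))
    obtain ⟨a, ha⟩ : ∃ a, ∀ z ∈ UHP,
        z.1 + z.2 * fderiv ℝ u z (0, 1) / fderiv ℝ u z (1, 0) = a :=
      ⟨_, fun z hz => S.base_const hpos hz (w := (0, 1)) (by simp [UHP])⟩
    have hU : ∀ z ∈ UHP, HasFDerivAt (fun z : ℝ × ℝ => 2 * Real.arctan ((z.1 - a) / z.2))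
        (fderiv ℝ u z) z := by
      intro z hz
      have hy : 0 < z.2 := hz
      have hne : z.2 ≠ 0 := hy.ne'
      have hdU : DifferentiableAt ℝ (fun z : ℝ × ℝ => 2 * Real.arctan ((z.1 - a) / z.2)) z := by
        have h1 : DifferentiableAt ℝ (fun z : ℝ × ℝ => (z.1 - a) / z.2) z := by
          fun_prop (disch := assumption)
        exact h1.arctan.const_mul 2
      have g1 : HasDerivAt (fun t : ℝ => 2 * Real.arctan ((t - a) / z.2))
          (fderiv ℝ (fun z : ℝ × ℝ => 2 * Real.arctan ((z.1 - a) / z.2)) z (1, 0)) z.1 :=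
        part_x hdU
      have g2 : HasDerivAt (fun t : ℝ => 2 * Real.arctan ((z.1 - a) / t))
          (fderiv ℝ (fun z : ℝ × ℝ => 2 * Real.arctan ((z.1 - a) / z.2)) z (0, 1)) z.2 :=
        part_y hdU
      have k1 := (((((hasDerivAt_id z.1).sub_const a).div_const z.2).arctan).const_mul 2).unique g1
      have k2 := ((((hasDerivAt_const z.2 (z.1 - a)).div (hasDerivAt_id z.2) hne).arctan).const_mul
        2).unique g2
      have hp := hpos z hz
      have hb := ha z hz
      have he := hHJ z.1 z.2 hy
      simp only [Prod.mk.eta] at he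
      have hq : z.2 * fderiv ℝ u z (0, 1) = fderiv ℝ u z (1, 0) * (a - z.1) := by
        rw [← hb]; field_simp; ring
      generalize hPd : fderiv ℝ u z (1, 0) = P at *
      generalize hQd : fderiv ℝ u z (0, 1) = Q at *
      have hP : P * (z.2 ^ 2 + (z.1 - a) ^ 2) = 2 * z.2 := by
        refine mul_left_cancel₀ hp.ne' ?_
        linear_combination he - (z.2 * Q + P * (a - z.1)) * hq
      have hD : z.2 ^ 2 + (z.1 - a) ^ 2 ≠ 0 := by positivity
      have hP' : P = 2 * z.2 / (z.2 ^ 2 + (z.1 - a) ^ 2) := by rw [eq_div_iff hD, hP]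
      have hQ' : Q = 2 * (a - z.1) / (z.2 ^ 2 + (z.1 - a) ^ 2) := by
        refine mul_left_cancel₀ hne ?_
        rw [hq, hP']; ring
      have hfe : fderiv ℝ u z
          = fderiv ℝ (fun z : ℝ × ℝ => 2 * Real.arctan ((z.1 - a) / z.2)) z := by
        have f1 : P = fderiv ℝ (fun z : ℝ × ℝ => 2 * Real.arctan ((z.1 - a) / z.2)) z (1, 0) := by
          rw [← k1, hP']
          simp only [id]
          field_simp
        have f2 : Q = fderiv ℝ (fun z : ℝ × ℝ => 2 * Real.arctan ((z.1 - a) / z.2)) z (0, 1) := by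
          rw [← k2, hQ']
          simp only [id, Pi.div_apply]
          field_simp
          ring
        apply ContinuousLinearMap.ext
        intro v
        have e : v = v.1 • ((1, 0) : ℝ × ℝ) + v.2 • ((0, 1) : ℝ × ℝ) := by ext <;> simp
        rw [e]
        simp only [map_add, map_smul]
        rw [hPd, hQd, f1, f2]
      rw [hfe]
      exact hdU.hasFDerivAt
    have hdiff : ∀ z ∈ UHP, HasFDerivAt
        (fun z : ℝ × ℝ => u z - 2 * Real.arctan ((z.1 - a) / z.2)) (0 : ℝ × ℝ →L[ℝ] ℝ) z := by
      intro z hz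
      have := (hud z hz).hasFDerivAt.sub (hU z hz)
      rwa [sub_self] at this
    obtain ⟨c, hc⟩ := UHP_open.exists_is_const_of_fderiv_eq_zero UHP_preconn
      (fun z hz => (hdiff z hz).differentiableAt.differentiableWithinAt)
      (fun z hz => (hdiff z hz).fderiv)
    refine ⟨a, c, fun x y hy => ?_⟩
    have := hc (x, y) hy
    simp only at this
    linarith
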